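/- arXiv:1809.01412 — 2 statements merged into one kernel-verified Lean document; each statement's English description precedes it below -/
import Mathlib

section
/- If m̂_n is a 0-stable predictor with respect to a class 𝒫 of distributions on Z satisfying Condition (C1), then there exists a collection {g_P : P ∈ 𝒫} of measurable functions g_P: X → ℝ such that for all P ∈ 𝒫: P^{n+1}({(T_n, z₀) ∈ Z^{n+1} : M_{n,p}(T_n, x₀) = g_P(x₀)}) = 1 and P^n({(T_{n−1}, z₀) ∈ Z^n : M_{n−1,p}(T_{n−1}, x₀) = g_P(x₀)}) = 1. -/
open MeasureTheory ProbabilityTheory Filter Topology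

noncomputable section

abbrev Vec (p : ℕ) := Fin p → ℝ
abbrev Obs (p : ℕ) := Vec p × ℝ

/-- Remove the `i`-th entry from an `n`-tuple. -/
def erase1 {Z : Type*} {n : ℕ} (T : Fin n → Z) (i : Fin n) (j : Fin (n - 1)) : Z :=
  have hj : (j : ℕ) < n - 1 := j.isLt
  if (j : ℕ) < (i : ℕ) then T ⟨j, by omega⟩ else T ⟨(j : ℕ) + 1, by omega⟩

/-- Remove the first entry from an `n`-tuple. -/
def dropFirst {Z : Type*} {n : ℕ} (T : Fin n → Z) (j : Fin (n - 1)) : Z :=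
  have hj : (j : ℕ) < n - 1 := j.isLt
  T ⟨(j : ℕ) + 1, by omega⟩

/-- The `k`-th smallest entry (0-based, clipped) of a real tuple. -/
def orderStat {n : ℕ} (u : Fin n → ℝ) (k : ℕ) : ℝ :=
  if h : n = 0 then 0 else (u ∘ Tuple.sort u) ⟨min k (n - 1), by omega⟩

/-- Empirical `α`-quantile of a tuple, as in the paper: `û_(⌈nα⌉)` for `α ∈ (0,1]`,
and `û_(1) - e^{-n}` for `α = 0`. -/
def qhat {n : ℕ} (u : Fin n → ℝ) (α : ℝ) : ℝ :=
  if α = 0 then orderStat u 0 - Real.exp (-(n : ℝ)) else orderStat u (⌈(n : ℝ) * α⌉₊ - 1)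

/-- Empirical distribution function of a tuple. -/
def empCDF {n : ℕ} (u : Fin n → ℝ) (s : ℝ) : ℝ :=
  ((Finset.univ.filter fun i : Fin n => u i ≤ s).card : ℝ) / n

/-- Conditional cdf of the prediction error `y₀ - g(x₀)` under `P`. -/
def errCDF {p : ℕ} (P : Measure (Obs p)) (g : Vec p → ℝ) (s : ℝ) : ℝ :=
  (P {z : Obs p | z.2 - g z.1 ≤ s}).toReal

/-- Coverage probability of the interval `(g(x₀)+q₁, g(x₀)+q₂]` under `P`. -/
def coverProb {p : ℕ} (P : Measure (Obs p)) (g : Vec p → ℝ) (q₁ q₂ : ℝ) : ℝ :=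
  (P {z : Obs p | g z.1 + q₁ < z.2 ∧ z.2 ≤ g z.1 + q₂}).toReal

/-- Condition (C1): `m` is the regression function of `P`, the error `u₀ = y₀ - m(x₀)` is
independent of `x₀` and has (bounded, nonnegative) Lebesgue density `f`. -/
def IsC1 {p : ℕ} (P : Measure (Obs p)) (m : Vec p → ℝ) (f : ℝ → ℝ) : Prop :=
  Measurable m ∧ (∀ s, 0 ≤ f s) ∧ BddAbove (Set.range f) ∧
    IndepFun (fun z : Obs p => z.1) (fun z : Obs p => z.2 - m z.1) P ∧
    Measure.map (fun z : Obs p => z.2 - m z.1) P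
      = volume.withDensity (fun s => ENNReal.ofReal (f s)) ∧
    Integrable (fun z : Obs p => z.2 - m z.1) P ∧
    (∫ z, (z.2 - m z.1) ∂P) = 0


/-- The training part of a sample `ω : Fin (n+1) → Z` (coordinate `0` is `z₀`). -/
def train {Z : Type*} {n : ℕ} (ω : Fin (n + 1) → Z) (i : Fin n) : Z := ω i.succ

section Helpers

/-- Reindexing a power of a probability measure along an injection preserves the measure. -/
theorem measurePreserving_pi_comp {I J Z : Type*} [Fintype I] [Fintype J] [MeasurableSpace Z]
    (P : Measure Z) [IsProbabilityMeasure P] {e : I → J} (he : Function.Injective e) :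
    MeasurePreserving (fun ω : J → Z => ω ∘ e)
      (Measure.pi fun _ : J => P) (Measure.pi fun _ : I => P) := by
  refine ⟨by fun_prop, ?_⟩
  have hind : iIndepFun (fun (j : J) (ω : J → Z) => ω j) (Measure.pi fun _ : J => P) :=
    iIndepFun_pi (X := fun _ => id) fun _ => aemeasurable_id
  have hmap := (iIndepFun_iff_map_fun_eq_pi_map
    (fun i => (measurable_pi_apply (e i)).aemeasurable)).1 (hind.precomp he)
  refine hmap.trans ?_
  congr 1
  funext i
  exact (measurePreserving_eval (fun _ : J => P) (e i)).map_eq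

theorem measurable_train {Z : Type*} [MeasurableSpace Z] {n : ℕ} :
    Measurable (train : (Fin (n + 1) → Z) → Fin n → Z) :=
  measurable_pi_lambda _ fun i => measurable_pi_apply i.succ

theorem measurable_erase1 {Z : Type*} [MeasurableSpace Z] {n : ℕ} (k : Fin n) :
    Measurable fun T : Fin n → Z => erase1 T k := by
  refine measurable_pi_lambda _ fun j => ?_
  unfold erase1
  dsimp only
  split_ifs <;> exact measurable_pi_apply _

theorem erase1_congr {Z : Type*} {n : ℕ} {T T' : Fin n → Z} {k : Fin n}
    (h : ∀ i, i ≠ k → T i = T' i) : erase1 T k = erase1 T' k := by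
  funext j
  unfold erase1
  dsimp only
  split_ifs with hj
  · exact h _ fun heq => by simp [← heq] at hj
  · exact h _ fun heq => by simp [← heq] at hj

theorem IsC1.iSup_density_pos {p : ℕ} {P : Measure (Obs p)} [IsProbabilityMeasure P]
    {m : Vec p → ℝ} {f : ℝ → ℝ} (h : IsC1 P m f) : 0 < ⨆ s, f s := by
  obtain ⟨hm, -, hbdd, -, hmap, -, -⟩ := h
  by_contra! hle
  have hf : (fun s => ENNReal.ofReal (f s)) = 0 := by
    funext s
    exact ENNReal.ofReal_of_nonpos ((le_ciSup hbdd s).trans hle)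
  have : IsProbabilityMeasure (Measure.map (fun z : Obs p => z.2 - m z.1) P) :=
    Measure.isProbabilityMeasure_map (by fun_prop)
  rw [hf, withDensity_zero] at hmap
  exact IsProbabilityMeasure.ne_zero _ hmap

theorem ae_eq_of_integral_min_nonpos {Ω : Type*} [MeasurableSpace Ω] {μ : Measure Ω}
    [IsFiniteMeasure μ] {a b : Ω → ℝ} (ha : Measurable a) (hb : Measurable b)
    {c : ℝ} (hc : 0 < c) (h : ∫ ω, min (c * |a ω - b ω|) 1 ∂μ ≤ 0) : a =ᵐ[μ] b := by
  have hnn : ∀ ω, 0 ≤ min (c * |a ω - b ω|) 1 := fun ω => by positivity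
  have hint : Integrable (fun ω => min (c * |a ω - b ω|) 1) μ := by
    refine Integrable.of_bound (C := 1) (by fun_prop) (ae_of_all _ fun ω => ?_)
    rw [Real.norm_of_nonneg (hnn ω)]
    exact min_le_right _ _
  have hzero := (integral_eq_zero_iff_of_nonneg hnn hint).1
    (le_antisymm h (integral_nonneg hnn))
  filter_upwards [hzero] with ω hω
  have habs : c * |a ω - b ω| = 0 := by
    have hω' : min (c * |a ω - b ω|) 1 = 0 := hω
    rcases min_choice (c * |a ω - b ω|) 1 with h' | h' <;> linarith
  have := (mul_eq_zero.1 habs).resolve_left hc.ne'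
  exact sub_eq_zero.1 (abs_eq_zero.1 this)

/-- The injection that takes the first `k` training points from an independent second sample. -/
def resampleIndex (n k : ℕ) : Fin (n + 1) → Fin (n + 1) ⊕ Fin n :=
  Fin.cases (Sum.inl 0) fun i => if (i : ℕ) < k then Sum.inr i else Sum.inl i.succ

theorem resampleIndex_injective (n k : ℕ) : Function.Injective (resampleIndex n k) := by
  intro a b
  refine Fin.cases ?_ (fun i => ?_) a <;> refine Fin.cases ?_ (fun j => ?_) b <;>
    simp only [resampleIndex, Fin.cases_zero, Fin.cases_succ]
  · simp
  · split_ifs <;> simp [(Fin.succ_ne_zero _).symm]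
  · split_ifs <;> simp
  · split_ifs <;> simp

/-- If deleting any one training point almost surely leaves the prediction unchanged, then the
prediction almost surely agrees with the one based on some fixed training sample. -/
theorem exists_ae_eq_fixed_sample {Z X : Type*} [MeasurableSpace Z] [MeasurableSpace X] {n : ℕ}
    (P : Measure Z) [IsProbabilityMeasure P] {π : Z → X}
    {M : (Fin n → Z) → X → ℝ} {L : (Fin (n - 1) → Z) → X → ℝ}
    (h : ∀ k : Fin n, ∀ᵐ ω ∂(Measure.pi fun _ : Fin (n + 1) => P),
      M (train ω) (π (ω 0)) = L (erase1 (train ω) k) (π (ω 0))) :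
    ∃ T : Fin n → Z, ∀ᵐ ω ∂(Measure.pi fun _ : Fin (n + 1) => P),
      M (train ω) (π (ω 0)) = M T (π (ω 0)) := by
  have hstep : ∀ k ≤ n, ∀ᵐ ω ∂(Measure.pi fun _ : Fin (n + 1) ⊕ Fin n => P),
      M (train (ω ∘ resampleIndex n 0)) (π (ω (Sum.inl 0)))
        = M (train (ω ∘ resampleIndex n k)) (π (ω (Sum.inl 0))) := by
    intro k
    induction k with
    | zero => exact fun _ => ae_of_all _ fun _ => rfl
    | succ k ih =>
      intro hk
      have hpull := fun l => (measurePreserving_pi_comp P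
        (resampleIndex_injective n l)).quasiMeasurePreserving.ae (h ⟨k, hk⟩)
      filter_upwards [ih (by omega), hpull k, hpull (k + 1)] with ω h₀ h₁ h₂
      refine h₀.trans (h₁.trans (Eq.trans ?_ h₂.symm))
      have herase : erase1 (train (ω ∘ resampleIndex n k)) ⟨k, hk⟩
          = erase1 (train (ω ∘ resampleIndex n (k + 1))) ⟨k, hk⟩ := by
        refine erase1_congr fun i hi => ?_
        have hne : (i : ℕ) ≠ k := fun h => hi (Fin.ext h)
        have hiff : (i : ℕ) < k ↔ (i : ℕ) < k + 1 := by omega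
        simp [train, resampleIndex, hiff]
      rw [herase]
      rfl
  have hprod := (measurePreserving_sumPiEquivProdPi_symm
    (fun _ : Fin (n + 1) ⊕ Fin n => P)).quasiMeasurePreserving.ae (hstep n le_rfl)
  have hswap := Measure.measurePreserving_swap.quasiMeasurePreserving.ae hprod
  obtain ⟨T, hT⟩ := (Measure.ae_ae_of_ae_prod hswap).exists
  refine ⟨T, ?_⟩
  filter_upwards [hT] with ω hω
  have h₀ : train ((MeasurableEquiv.sumPiEquivProdPi fun _ : Fin (n + 1) ⊕ Fin n => Z).symm (ω, T)
      ∘ resampleIndex n 0) = train ω := by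
    funext i
    simp [train, resampleIndex]
    rfl
  have h₁ : train ((MeasurableEquiv.sumPiEquivProdPi fun _ : Fin (n + 1) ⊕ Fin n => Z).symm (ω, T)
      ∘ resampleIndex n n) = T := by
    funext i
    simp [train, resampleIndex]
    rfl
  simp only [Prod.swap_prod_mk, h₀, h₁] at hω
  exact hω

end Helpers

/-- Lemma 11 of the paper: a `0`-stable predictor is almost surely a
fixed function of the new feature vector, under every member of the class. The class
satisfying (C1) is presented as an indexed family `(P i, mreg i, f i)_{i : ι}`; the
training sample has size `n = m + 1`. -/
theorem stmt16 {p m : ℕ} (ι : Type*)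
    (P : ι → Measure (Obs p)) (mreg : ι → Vec p → ℝ) (f : ι → ℝ → ℝ)
    (hprob : ∀ i, IsProbabilityMeasure (P i))
    (hC1 : ∀ i, IsC1 (P i) (mreg i) (f i))
    (Mfull : (Fin (m + 1) → Obs p) → Vec p → ℝ) (Mloo : (Fin m → Obs p) → Vec p → ℝ)
    (hMfull : Measurable (Function.uncurry Mfull)) (hMloo : Measurable (Function.uncurry Mloo))
    -- `0`-stability with respect to the class :
    (hstable : ∀ (i : ι) (k : Fin (m + 1)),
      (∫ ω : Fin (m + 2) → Obs p,
          min ((⨆ s : ℝ, f i s) * |Mfull (train ω) (ω 0).1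
              - Mloo (erase1 (train ω) k) (ω 0).1|) 1
          ∂(Measure.pi fun _ : Fin (m + 2) => P i)) ≤ 0) :
    ∃ g : ι → Vec p → ℝ, ∀ i : ι, Measurable (g i)
      ∧ (Measure.pi fun _ : Fin (m + 2) => P i)
          {ω : Fin (m + 2) → Obs p | Mfull (train ω) (ω 0).1 = g i (ω 0).1} = 1
      ∧ (Measure.pi fun _ : Fin (m + 1) => P i)
          {ω : Fin (m + 1) → Obs p | Mloo (fun j : Fin m => ω j.succ) (ω 0).1
            = g i (ω 0).1} = 1 := by
  have key : ∀ i, ∃ g : Vec p → ℝ, Measurable g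
      ∧ (∀ᵐ ω ∂(Measure.pi fun _ : Fin (m + 2) => P i), Mfull (train ω) (ω 0).1 = g (ω 0).1)
      ∧ ∀ᵐ ω ∂(Measure.pi fun _ : Fin (m + 1) => P i),
          Mloo (fun j : Fin m => ω j.succ) (ω 0).1 = g (ω 0).1 := by
    intro i
    have := hprob i
    have hx : Measurable fun ω : Fin (m + 2) → Obs p => (ω 0).1 := by fun_prop
    have hae : ∀ k : Fin (m + 1), ∀ᵐ ω ∂(Measure.pi fun _ : Fin (m + 2) => P i),
        Mfull (train ω) (ω 0).1 = Mloo (erase1 (train ω) k) (ω 0).1 := fun k =>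
      ae_eq_of_integral_min_nonpos
        (hMfull.comp (measurable_train.prodMk hx))
        (hMloo.comp (((measurable_erase1 k).comp measurable_train).prodMk hx))
        (hC1 i).iSup_density_pos (hstable i k)
    obtain ⟨T, hT⟩ := exists_ae_eq_fixed_sample (P i) (π := Prod.fst) hae
    have hg : Measurable (Mfull T) := hMfull.of_uncurry_left
    refine ⟨Mfull T, hg, hT, ?_⟩
    have hmp := measurePreserving_pi_comp (P i)
      (Fin.succAbove_right_injective (p := (1 : Fin (m + 2))))
    rw [← hmp.map_eq, ae_map_iff hmp.measurable.aemeasurable]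
    · filter_upwards [hae 0, hT] with ω h₀ h₁
      have hidx : (fun j : Fin m => (ω ∘ Fin.succAbove 1) j.succ) = erase1 (train ω) 0 := by
        funext j
        simp only [Function.comp_apply, erase1, train]
        rw [Fin.succAbove_of_le_castSucc _ _ (by simp [Fin.le_def])]
        rfl
      have hzero : (ω ∘ Fin.succAbove 1) (0 : Fin (m + 1)) = ω 0 := by simp
      rw [hidx, hzero]
      exact h₀.symm.trans h₁
    · refine measurableSet_eq_fun (hMloo.comp (Measurable.prodMk ?_ ?_)) (hg.comp ?_) <;> fun_prop
  choose g hg hfull hloo using key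
  refine ⟨g, fun i => ⟨hg i, ?_, ?_⟩⟩
  · have := hprob i
    exact (measure_congr (eventuallyEq_univ.2 (hfull i))).trans measure_univ
  · have := hprob i
    exact (measure_congr (eventuallyEq_univ.2 (hloo i))).trans measure_univ

end
end

section
/- Suppose the predictor does not depend on the training data, i.e., M_{n,p}(T_n, x) = m(x) for a fixed measurable m: X → ℝ, and suppose the cdf F̃(s) = P(y₀ − m(x₀) ≤ s) is continuous. Then for 0 ≤ α₁ < α₂ ≤ 1 and every ε > 0: P^n( |P(y₀ ∈ PI^{(L1O)}_{α₁,α₂}(T_n,x₀)) − (⌈nα₂⌉ − ⌈nα₁⌉)/n| > ε ) ≤ 2 exp(−nε²/2), and consequently E_{P^n}[ |P(y₀ ∈ PI^{(L1O)}_{α₁,α₂}(T_n,x₀)) − (⌈nα₂⌉ − ⌈nα₁⌉)/n| ] ≤ √(2π/n). -/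
open MeasureTheory ProbabilityTheory Filter Topology

noncomputable section

lemma orderStat_of_lt {n : ℕ} (u : Fin n → ℝ) {k : ℕ} (hk : k < n) :
    orderStat u k = u (Tuple.sort u ⟨k, hk⟩) := by
  have h0 : n ≠ 0 := by omega
  have h1 : min k (n - 1) = k := by omega
  simp [orderStat, h0, h1]

lemma orderStat_mono {n : ℕ} (u : Fin n → ℝ) : Monotone (orderStat u) := by
  intro k l hkl
  unfold orderStat
  split_ifs with h
  · exact le_rfl
  · exact Tuple.monotone_sort u (Fin.mk_le_mk.2 (by omega))

lemma Monotone.map_orderStat {n : ℕ} {f : ℝ → ℝ} (hf : Monotone f) (u : Fin n → ℝ) {k : ℕ}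
    (hk : k < n) : f (orderStat u k) = orderStat (f ∘ u) k := by
  rw [orderStat_of_lt _ hk, orderStat_of_lt _ hk]
  have h : (f ∘ u) ∘ Tuple.sort u = (f ∘ u) ∘ Tuple.sort (f ∘ u) :=
    Tuple.comp_sort_eq_comp_iff_monotone.2 (hf.comp (Tuple.monotone_sort u))
  exact congrFun h ⟨k, hk⟩

/-- The number of entries of a real tuple that are at most `s`. -/
def countLE {n : ℕ} (u : Fin n → ℝ) (s : ℝ) : ℕ :=
  (Finset.univ.filter fun i : Fin n => u i ≤ s).card

lemma orderStat_le_iff {n : ℕ} (u : Fin n → ℝ) {k : ℕ} (hk : k < n) (s : ℝ) :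
    orderStat u k ≤ s ↔ k < countLE u s := by
  have h := Tuple.lt_card_le_iff_apply_le_of_monotone (a := s) (j := ⟨k, hk⟩)
    (Tuple.monotone_sort u)
  rw [orderStat_of_lt _ hk]
  refine h.symm.trans ?_
  unfold countLE
  rw [Finset.card_equiv (Tuple.sort u) (t := Finset.univ.filter fun i : Fin n => u i ≤ s)
    (by simp)]

lemma countLE_sort {n : ℕ} {u : Fin n → ℝ} (hu : Function.Injective u) (l : Fin n) :
    countLE u (u (Tuple.sort u l)) = l + 1 := by
  have hs : StrictMono (u ∘ Tuple.sort u) :=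
    (Tuple.monotone_sort u).strictMono_of_injective (hu.comp (Tuple.sort u).injective)
  rw [← Fin.card_Iic l]
  symm
  refine Finset.card_equiv (Tuple.sort u) fun i => ?_
  simpa using (hs.le_iff_le (a := i) (b := l)).symm

lemma orderStat_eq_of_countLE {n : ℕ} {u : Fin n → ℝ} (hu : Function.Injective u) {k : ℕ}
    (hk : k < n) {c : Fin n} (hc : countLE u (u c) = k + 1) : orderStat u k = u c := by
  obtain ⟨l, rfl⟩ := (Tuple.sort u).surjective c
  rw [countLE_sort hu] at hc
  have : l = ⟨k, hk⟩ := Fin.ext (by simpa using hc)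
  rw [orderStat_of_lt _ hk, this]

lemma countLE_injective {n : ℕ} {u : Fin n → ℝ} (hu : Function.Injective u) {a b : Fin n}
    (h : countLE u (u a) = countLE u (u b)) : a = b := by
  obtain ⟨l, rfl⟩ := (Tuple.sort u).surjective a
  obtain ⟨l', rfl⟩ := (Tuple.sort u).surjective b
  rw [countLE_sort hu, countLE_sort hu] at h
  rw [Fin.ext (by omega : (l : ℕ) = l')]

lemma measurable_countLE {n : ℕ} {f : (Fin n → ℝ) → ℝ} (hf : Measurable f) :
    Measurable fun u : Fin n → ℝ => countLE u (f u) := by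
  simp only [countLE, Finset.card_filter]
  refine Finset.measurable_sum _ fun i _ => ?_
  exact Measurable.ite (measurableSet_le (measurable_pi_apply i) hf) measurable_const
    measurable_const

lemma measurable_orderStat {n k : ℕ} (hk : k < n) :
    Measurable fun u : Fin n → ℝ => orderStat u k := by
  refine measurable_of_Iic fun s => ?_
  have : (fun u : Fin n → ℝ => orderStat u k) ⁻¹' Set.Iic s
      = (fun u => countLE u s) ⁻¹' Set.Ioi k := by
    ext u
    simp [orderStat_le_iff u hk]
  rw [this]
  exact measurable_countLE measurable_const measurableSet_Ioi

/-- Rotate the unit circle so that the `a`-th entry moves to `0`, and replace that entry by the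
new position of the old origin. -/
def rotateAt {n : ℕ} (a : Fin n) (v : Fin n → ℝ) (b : Fin n) : ℝ :=
  Int.fract ((if b = a then 0 else v b) - v a)

/-- Tuples of distinct points of the open unit interval. -/
def distinctUnit (n : ℕ) : Set (Fin n → ℝ) :=
  {v | Function.Injective v ∧ ∀ b, v b ∈ Set.Ioo (0 : ℝ) 1}

section Rotate

variable {n : ℕ} {a : Fin n} {v : Fin n → ℝ}

lemma rotateAt_self (hv : v ∈ distinctUnit n) : rotateAt a v a = 1 - v a := by
  have := hv.2 a
  simp only [rotateAt, if_true]
  rw [Int.fract_eq_iff]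
  exact ⟨by linarith [this.2], by linarith [this.1], -1, by push_cast; ring⟩

lemma rotateAt_of_gt (hv : v ∈ distinctUnit n) {b : Fin n} (h : v a < v b) :
    rotateAt a v b = v b - v a := by
  have hb : b ≠ a := by rintro rfl; exact lt_irrefl _ h
  simp only [rotateAt, if_neg hb]
  rw [Int.fract_eq_iff]
  exact ⟨by linarith, by linarith [(hv.2 a).1, (hv.2 b).2], 0, by push_cast; ring⟩

lemma rotateAt_of_lt (hv : v ∈ distinctUnit n) {b : Fin n} (h : v b < v a) :
    rotateAt a v b = v b - v a + 1 := by
  have hb : b ≠ a := by rintro rfl; exact lt_irrefl _ h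
  simp only [rotateAt, if_neg hb]
  rw [Int.fract_eq_iff]
  exact ⟨by linarith [(hv.2 b).1, (hv.2 a).2], by linarith, -1, by push_cast; ring⟩

lemma rotateAt_cases (hv : v ∈ distinctUnit n) (b : Fin n) :
    (b = a ∧ rotateAt a v b = 1 - v a) ∨ (v a < v b ∧ rotateAt a v b = v b - v a) ∨
      (v b < v a ∧ rotateAt a v b = v b - v a + 1) := by
  rcases lt_trichotomy (v b) (v a) with h | h | h
  · exact .inr (.inr ⟨h, rotateAt_of_lt hv h⟩)
  · obtain rfl := hv.1 h
    exact .inl ⟨rfl, rotateAt_self hv⟩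
  · exact .inr (.inl ⟨h, rotateAt_of_gt hv h⟩)

lemma rotateAt_mem_distinctUnit (hv : v ∈ distinctUnit n) : rotateAt a v ∈ distinctUnit n := by
  refine ⟨fun b c h => ?_, fun b => ?_⟩
  · have hb := hv.2 b
    have hc := hv.2 c
    rcases rotateAt_cases (a := a) hv b with ⟨e, h1⟩ | ⟨e, h1⟩ | ⟨e, h1⟩ <;>
    rcases rotateAt_cases (a := a) hv c with ⟨e', h2⟩ | ⟨e', h2⟩ | ⟨e', h2⟩ <;>
    first
    | exact e.trans e'.symm
    | (exact hv.1 (by linarith))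
    | (exfalso; linarith [hb.1, hb.2, hc.1, hc.2])
  · have hb := hv.2 b
    have ha := hv.2 a
    rcases rotateAt_cases (a := a) hv b with ⟨e, h1⟩ | ⟨e, h1⟩ | ⟨e, h1⟩ <;>
    exact ⟨by linarith [hb.1, hb.2, ha.1, ha.2], by linarith [hb.1, hb.2, ha.1, ha.2]⟩

lemma countLE_rotateAt_self (hv : v ∈ distinctUnit n) :
    countLE (rotateAt a v) (rotateAt a v a) = n + 1 - countLE v (v a) := by
  have h1 : (Finset.univ.filter fun b => rotateAt a v b ≤ rotateAt a v a)
      = insert a (Finset.univ.filter fun b => ¬ v b ≤ v a) := by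
    ext b
    have hb := hv.2 b
    rw [rotateAt_self hv]
    simp only [Finset.mem_filter, Finset.mem_univ, true_and, Finset.mem_insert, not_le]
    rcases rotateAt_cases (a := a) hv b with ⟨e, h1⟩ | ⟨e, h1⟩ | ⟨e, h1⟩
    · simp only [e, true_or, iff_true]
      subst e; exact h1.le
    · simp only [h1, e, or_true, iff_true]
      linarith [hb.2]
    · have hne : b ≠ a := by rintro rfl; exact lt_irrefl _ e
      simp only [h1, hne, false_or, not_lt.2 e.le, iff_false]
      linarith [hb.1]
  have h2 := Finset.card_filter_add_card_filter_not (s := (Finset.univ : Finset (Fin n)))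
    (fun b => v b ≤ v a)
  unfold countLE
  rw [h1, Finset.card_insert_of_notMem (by simp)]
  simp only [Finset.card_univ, Fintype.card_fin] at h2
  omega

lemma countLE_rotateAt_of_gt (hv : v ∈ distinctUnit n) {c : Fin n} (hc : v a < v c) :
    countLE (rotateAt a v) (rotateAt a v c) = countLE v (v c) - countLE v (v a) := by
  have h1 : (Finset.univ.filter fun b => rotateAt a v b ≤ rotateAt a v c)
      = (Finset.univ.filter fun b => v b ≤ v c) \ (Finset.univ.filter fun b => v b ≤ v a) := by
    ext b
    have hb := hv.2 b
    have hc' := hv.2 c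
    rw [rotateAt_of_gt hv hc]
    simp only [Finset.mem_filter, Finset.mem_univ, true_and, Finset.mem_sdiff, not_le]
    rcases rotateAt_cases (a := a) hv b with ⟨e, h1⟩ | ⟨e, h1⟩ | ⟨e, h1⟩
    · subst e
      simp only [h1, lt_irrefl, and_false, iff_false]
      linarith [hc'.2]
    · simp [h1, e]
    · simp only [h1, not_lt.2 e.le, and_false, iff_false]
      linarith [hc'.2, hb.1]
  unfold countLE
  rw [h1, Finset.card_sdiff_of_subset]
  intro b
  simp only [Finset.mem_filter, Finset.mem_univ, true_and]
  exact fun h => h.trans hc.le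

/-- Rotating at the `i`-th smallest entry turns a spacing into an order statistic. -/
lemma orderStat_rotateAt (hv : v ∈ distinctUnit n) {i k : ℕ} (hik : i + k + 1 < n)
    (ha : countLE v (v a) = i + 1) :
    orderStat (rotateAt a v) k = orderStat v (i + k + 1) - orderStat v i := by
  have hi : orderStat v i = v a := orderStat_eq_of_countLE hv.1 (by omega) ha
  set c := Tuple.sort v ⟨i + k + 1, hik⟩
  have hc : orderStat v (i + k + 1) = v c := orderStat_of_lt _ hik
  have hcc : countLE v (v c) = i + k + 1 + 1 := countLE_sort hv.1 _
  have hac : v a < v c := by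
    refine lt_of_le_of_ne ?_ fun h => ?_
    · rw [← hi, ← hc]
      exact orderStat_mono v (by omega)
    · rw [h] at ha
      omega
  rw [hi, hc, ← rotateAt_of_gt hv hac]
  refine orderStat_eq_of_countLE (rotateAt_mem_distinctUnit hv).1 (by omega) ?_
  rw [countLE_rotateAt_of_gt hv hac]
  omega

end Rotate
/-- The uniform distribution on the unit interval. -/
def unitUniform : Measure ℝ := volume.restrict (Set.Ioo 0 1)

instance : IsProbabilityMeasure unitUniform := ⟨by simp [unitUniform]⟩

instance : NullSingletonClass unitUniform := by unfold unitUniform; infer_instance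

lemma ae_unitUniform_mem : ∀ᵐ x ∂unitUniform, x ∈ Set.Ioo (0 : ℝ) 1 :=
  ae_restrict_mem measurableSet_Ioo

lemma unitUniform_real_Iic {s : ℝ} (h0 : 0 ≤ s) (h1 : s ≤ 1) :
    unitUniform.real (Set.Iic s) = s := by
  rw [unitUniform, restrict_Ioo_eq_restrict_Ioc, measureReal_restrict_apply measurableSet_Iic,
    Set.Iic_inter_Ioc_of_le h1]
  simp [h0]

lemma measurePreserving_coe_unitUniform :
    MeasurePreserving ((↑) : ℝ → UnitAddCircle) unitUniform volume := by
  rw [unitUniform, restrict_Ioo_eq_restrict_Ioc]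
  simpa using UnitAddCircle.measurePreserving_mk 0

lemma measurePreserving_equivIco_unitUniform :
    MeasurePreserving (fun w : UnitAddCircle => (AddCircle.equivIco 1 0 w : ℝ))
      volume unitUniform := by
  have hm : Measurable fun w : UnitAddCircle => (AddCircle.equivIco 1 0 w : ℝ) :=
    measurable_subtype_coe.comp (AddCircle.measurableEquivIco 1 0).measurable
  refine ⟨hm, ?_⟩
  rw [← measurePreserving_coe_unitUniform.map_eq,
    Measure.map_map hm measurePreserving_coe_unitUniform.measurable]
  conv_rhs => rw [← Measure.map_id (μ := unitUniform)]
  refine Measure.map_congr ?_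
  filter_upwards [ae_unitUniform_mem] with x hx
  simp [AddCircle.coe_equivIco_mk_apply, Int.fract_eq_self.2 ⟨hx.1.le, hx.2⟩]

/-- The involution of the torus that `rotateAt` represents. -/
def torusRotate {n : ℕ} (a : Fin n) : (Fin n → UnitAddCircle) →+ (Fin n → UnitAddCircle) where
  toFun w b := (if b = a then 0 else w b) - w a
  map_zero' := by ext b; simp
  map_add' w w' := by
    ext b
    simp only [Pi.add_apply]
    split_ifs <;> abel

lemma torusRotate_torusRotate {n : ℕ} (a : Fin n) (w : Fin n → UnitAddCircle) :
    torusRotate a (torusRotate a w) = w := by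
  ext b
  by_cases h : b = a <;> simp [torusRotate, h]

lemma measurePreserving_torusRotate {n : ℕ} (a : Fin n) :
    MeasurePreserving (torusRotate a) (volume : Measure (Fin n → UnitAddCircle)) volume := by
  refine AddMonoidHom.measurePreserving ?_ (fun w => ⟨_, torusRotate_torusRotate a w⟩) rfl
  refine continuous_pi fun b => ?_
  change Continuous fun w : Fin n → UnitAddCircle => (if b = a then 0 else w b) - w a
  split_ifs <;> fun_prop

lemma measurePreserving_rotateAt {n : ℕ} (a : Fin n) :
    MeasurePreserving (rotateAt a) (Measure.pi fun _ : Fin n => unitUniform)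
      (Measure.pi fun _ : Fin n => unitUniform) := by
  have h1 := measurePreserving_pi (fun _ : Fin n => unitUniform)
    (fun _ : Fin n => (volume : Measure UnitAddCircle)) fun _ => measurePreserving_coe_unitUniform
  have h2 := measurePreserving_pi (fun _ : Fin n => (volume : Measure UnitAddCircle))
    (fun _ : Fin n => unitUniform) fun _ => measurePreserving_equivIco_unitUniform
  convert! h2.comp ((measurePreserving_torusRotate a).comp h1) using 1
  ext v b
  have : torusRotate a (fun i => (v i : UnitAddCircle)) b
      = (((if b = a then 0 else v b) - v a : ℝ) : UnitAddCircle) := by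
    by_cases h : b = a <;> simp [torusRotate, h]
  simp only [Function.comp_def, this, rotateAt, AddCircle.coe_equivIco_mk_apply, div_one, mul_one]

lemma ae_mem_distinctUnit (n : ℕ) :
    ∀ᵐ v ∂(Measure.pi fun _ : Fin n => unitUniform), v ∈ distinctUnit n := by
  have h1 : ∀ᵐ v ∂(Measure.pi fun _ : Fin n => unitUniform), ∀ b, v b ∈ Set.Ioo (0 : ℝ) 1 :=
    ae_all_iff.2 fun b =>
      (measurePreserving_eval (fun _ : Fin n => unitUniform) b).quasiMeasurePreserving.ae
        ae_unitUniform_mem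
  have h2 : ∀ᵐ v ∂(Measure.pi fun _ : Fin n => unitUniform), ∀ a b, a ≠ b → v a ≠ v b := by
    refine ae_all_iff.2 fun a => ae_all_iff.2 fun b => ?_
    by_cases hab : a = b
    · simp [hab]
    have hind : IndepFun (fun v : Fin n → ℝ => v a) (fun v => v b)
        (Measure.pi fun _ : Fin n => unitUniform) :=
      (iIndepFun_pi (X := fun _ : Fin n => (id : ℝ → ℝ))
        fun _ => aemeasurable_id).indepFun hab
    have hmap := (indepFun_iff_map_prod_eq_prod_map_map
      (measurable_pi_apply a).aemeasurable (measurable_pi_apply b).aemeasurable).1 hind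
    rw [(measurePreserving_eval (fun _ : Fin n => unitUniform) a).map_eq,
      (measurePreserving_eval (fun _ : Fin n => unitUniform) b).map_eq] at hmap
    have hd : ∀ᵐ x ∂(unitUniform.prod unitUniform), x.1 ≠ x.2 := by
      have hms : MeasurableSet {x : ℝ × ℝ | x.1 ≠ x.2} :=
        (measurableSet_eq_fun measurable_fst measurable_snd).compl
      rw [Measure.ae_prod_iff_ae_ae hms]
      refine ae_of_all _ fun x => ?_
      rw [ae_iff]
      simp
    rw [← hmap] at hd
    filter_upwards [ae_of_ae_map (by fun_prop) hd] with v hv _ using hv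
  filter_upwards [h1, h2] with v hv1 hv2
  exact ⟨fun a b h => by_contra fun hab => hv2 a b hab h, hv1⟩

/-- Hoeffding's inequality for both tails of the number of uniform variables below a level. -/
lemma unitUniform_countLE_tails {n : ℕ} (hn : 1 ≤ n) {s : ℝ} (h0 : 0 ≤ s) (h1 : s ≤ 1) {x : ℝ}
    (hx : 0 ≤ x) :
    (Measure.pi fun _ : Fin n => unitUniform).real {v | n * (s + x) ≤ countLE v s}
        ≤ Real.exp (-2 * n * x ^ 2) ∧
      (Measure.pi fun _ : Fin n => unitUniform).real {v | (countLE v s : ℝ) ≤ n * (s - x)}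
        ≤ Real.exp (-2 * n * x ^ 2) := by
  set f : ℝ → ℝ := (Set.Iic s).indicator 1 with hf
  have hfm : Measurable f := measurable_one.indicator measurableSet_Iic
  have hmean : ∫ y, f y ∂unitUniform = s := by
    rw [hf, integral_indicator_one measurableSet_Iic, unitUniform_real_Iic h0 h1]
  have hcount : ∀ v : Fin n → ℝ, (countLE v s : ℝ) = ∑ i, f (v i) := by
    intro v
    simp [countLE, hf, Set.indicator_apply]
  have hsub := hasSubgaussianMGF_of_mem_Icc (μ := unitUniform) (X := f) (a := 0) (b := 1)
    hfm.aemeasurable (ae_of_all _ fun y => by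
      by_cases h : y ≤ s <;> simp [hf, h])
  rw [hmean] at hsub
  have hn' : (0 : ℝ) < n := by exact_mod_cast hn
  have key : ∀ g : ℝ → ℝ, HasSubgaussianMGF g ((‖(1 : ℝ) - 0‖₊ / 2) ^ 2) unitUniform →
      (Measure.pi fun _ : Fin n => unitUniform).real {v | n * x ≤ ∑ i, g (v i)}
        ≤ Real.exp (-2 * n * x ^ 2) := by
    intro g hg
    have hi : iIndepFun (fun (i : Fin n) (v : Fin n → ℝ) => g (v i))
        (Measure.pi fun _ : Fin n => unitUniform) :=
      iIndepFun_pi (X := fun _ : Fin n => g) fun _ => hg.aemeasurable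
    have := HasSubgaussianMGF.measure_sum_ge_le_of_iIndepFun hi (s := Finset.univ)
      (c := fun _ => (‖(1 : ℝ) - 0‖₊ / 2) ^ 2) (ε := n * x) (fun i _ => by
        refine HasSubgaussianMGF.of_map (Y := fun v : Fin n → ℝ => v i) (X := g)
          (measurable_pi_apply i).aemeasurable ?_
        rwa [(measurePreserving_eval (fun _ : Fin n => unitUniform) i).map_eq]) (by positivity)
    refine this.trans_eq ?_
    congr 1
    simp
    field_simp
  constructor
  · convert key _ hsub using 4 with v
    simp only [Finset.sum_sub_distrib, ← hcount]
    simp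
    constructor <;> intro h <;> linarith
  · convert key _ hsub.neg using 4 with v
    simp only [Pi.neg_apply, Finset.sum_neg_distrib, Finset.sum_sub_distrib, ← hcount]
    simp
    constructor <;> intro h <;> linarith

/-- Spacings of uniform order statistics are distributed like order statistics. -/
lemma measure_spacing_le {n i k : ℕ} (hik : i + k + 1 < n) {B : Set ℝ} (hB : MeasurableSet B) :
    (Measure.pi fun _ : Fin n => unitUniform) {v | orderStat v (i + k + 1) - orderStat v i ∈ B}
      ≤ (Measure.pi fun _ : Fin n => unitUniform) {v | orderStat v k ∈ B} := by
  set μ := Measure.pi fun _ : Fin n => unitUniform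
  set G : Fin n → Set (Fin n → ℝ) := fun a =>
    {v | orderStat v k ∈ B} ∩ {v | countLE v (v a) = n - i}
  have hGm : ∀ a, MeasurableSet (G a) := fun a =>
    (measurable_orderStat (by omega) hB).inter
      (measurable_countLE (measurable_pi_apply a) (measurableSet_singleton (n - i)))
  have hdisj : Pairwise (Function.onFun (AEDisjoint μ) G) := by
    intro a b hab
    refine measure_mono_null (t := (distinctUnit n)ᶜ) ?_ (ae_mem_distinctUnit n)
    rintro v ⟨⟨-, ha⟩, -, hb⟩ hv
    exact hab (countLE_injective hv.1 (Eq.trans ha (Eq.symm hb)))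
  calc μ {v | orderStat v (i + k + 1) - orderStat v i ∈ B}
      ≤ μ (⋃ a, rotateAt a ⁻¹' G a) := by
        refine measure_mono_ae ?_
        filter_upwards [ae_mem_distinctUnit n] with v hv hvB
        have ha : countLE v (v (Tuple.sort v ⟨i, by omega⟩)) = i + 1 := countLE_sort hv.1 _
        refine Set.mem_iUnion.2 ⟨Tuple.sort v ⟨i, by omega⟩, ?_, ?_⟩
        · change orderStat _ k ∈ B
          rw [orderStat_rotateAt hv hik ha]
          exact hvB
        · change countLE _ _ = _
          rw [countLE_rotateAt_self hv, ha]
          omega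
    _ ≤ ∑ a, μ (rotateAt a ⁻¹' G a) := measure_iUnion_fintype_le _ _
    _ = ∑ a, μ (G a) := Finset.sum_congr rfl fun a _ =>
        (measurePreserving_rotateAt a).measure_preimage (hGm a).nullMeasurableSet
    _ = μ (⋃ a, G a) := by
        rw [measure_iUnion₀ hdisj fun a => (hGm a).nullMeasurableSet, tsum_fintype]
    _ ≤ μ {v | orderStat v k ∈ B} :=
        measure_mono (Set.iUnion_subset fun a => Set.inter_subset_left)

lemma measureReal_spacing_le {n i k : ℕ} (hik : i + k + 1 < n) {B : Set ℝ}
    (hB : MeasurableSet B) :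
    (Measure.pi fun _ : Fin n => unitUniform).real
        {v | orderStat v (i + k + 1) - orderStat v i ∈ B}
      ≤ (Measure.pi fun _ : Fin n => unitUniform).real {v | orderStat v k ∈ B} :=
  ENNReal.toReal_mono (measure_ne_top _ _) (measure_spacing_le hik hB)

lemma orderStat_mem_Ioo {n k : ℕ} (hk : k < n) {v : Fin n → ℝ} (hv : v ∈ distinctUnit n) :
    orderStat v k ∈ Set.Ioo (0 : ℝ) 1 := by
  rw [orderStat_of_lt _ hk]
  exact hv.2 _

lemma orderStat_upper_tail {n k : ℕ} (hk : k < n) {x : ℝ} (hx : 0 ≤ x) :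
    (Measure.pi fun _ : Fin n => unitUniform).real {v | ((k : ℝ) + 1) / n + x < orderStat v k}
      ≤ Real.exp (-2 * n * (x + 1 / n) ^ 2) := by
  have hn : (0 : ℝ) < n := by exact_mod_cast (by omega : 0 < n)
  rcases le_total (((k : ℝ) + 1) / n + x) 1 with h1 | h1
  · refine (measureReal_mono ?_).trans
      (unitUniform_countLE_tails (by omega) (by positivity) h1 (by positivity)).2
    intro v hv
    have hc : countLE v (((k : ℝ) + 1) / n + x) ≤ k :=
      not_lt.1 fun h => not_le.2 hv ((orderStat_le_iff v hk _).2 h)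
    have hc' : (countLE v (((k : ℝ) + 1) / n + x) : ℝ) ≤ k := by exact_mod_cast hc
    refine hc'.trans_eq ?_
    field_simp
    ring
  · have : (Measure.pi fun _ : Fin n => unitUniform)
        {v | ((k : ℝ) + 1) / n + x < orderStat v k} = 0 := by
      refine measure_mono_null (t := (distinctUnit n)ᶜ) ?_ (ae_mem_distinctUnit n)
      intro v hv hvD
      exact absurd (h1.trans_lt hv) (not_lt.2 (orderStat_mem_Ioo hk hvD).2.le)
    rw [measureReal_def, this]
    positivity

lemma orderStat_lower_tail {n k : ℕ} (hk : k < n) {x : ℝ} (hx : 0 ≤ x) :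
    (Measure.pi fun _ : Fin n => unitUniform).real {v | orderStat v k < ((k : ℝ) + 1) / n - x}
      ≤ Real.exp (-2 * n * x ^ 2) := by
  have hn : (0 : ℝ) < n := by exact_mod_cast (by omega : 0 < n)
  rcases le_total 0 (((k : ℝ) + 1) / n - x) with h0 | h0
  · have hle : ((k : ℝ) + 1) / n ≤ 1 := by
      rw [div_le_one hn]
      exact_mod_cast hk
    refine (measureReal_mono ?_).trans
      (unitUniform_countLE_tails (by omega) h0 (by linarith) hx).1
    intro v hv
    have hc := (orderStat_le_iff v hk _).1 (le_of_lt hv)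
    have hc' : (k : ℝ) + 1 ≤ countLE v (((k : ℝ) + 1) / n - x) := by exact_mod_cast hc
    refine le_trans (le_of_eq ?_) hc'
    field_simp
    ring
  · have : (Measure.pi fun _ : Fin n => unitUniform)
        {v | orderStat v k < ((k : ℝ) + 1) / n - x} = 0 := by
      refine measure_mono_null (t := (distinctUnit n)ᶜ) ?_ (ae_mem_distinctUnit n)
      intro v hv hvD
      exact absurd (lt_of_lt_of_le hv h0) (not_lt.2 (orderStat_mem_Ioo hk hvD).1.le)
    rw [measureReal_def, this]
    positivity

lemma spacing_deviation_tail {n i k : ℕ} (hik : i + k + 1 < n) {ε : ℝ} (hε : 0 < ε) :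
    (Measure.pi fun _ : Fin n => unitUniform).real
        {v | ε < |orderStat v (i + k + 1) - orderStat v i - ((k : ℝ) + 1) / n|}
      ≤ 2 * Real.exp (-(n : ℝ) * ε ^ 2 / 2) := by
  set μ := Measure.pi fun _ : Fin n => unitUniform
  have hn : (0 : ℝ) < n := by exact_mod_cast (by omega : 0 < n)
  have hU := (measureReal_spacing_le hik (B := Set.Ioi (((k : ℝ) + 1) / n + ε))
    measurableSet_Ioi).trans (orderStat_upper_tail (by omega) hε.le)
  have hL := (measureReal_spacing_le hik (B := Set.Iio (((k : ℝ) + 1) / n - ε))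
    measurableSet_Iio).trans (orderStat_lower_tail (by omega) hε.le)
  have hsub : {v : Fin n → ℝ | ε < |orderStat v (i + k + 1) - orderStat v i - ((k : ℝ) + 1) / n|}
      ⊆ {v | orderStat v (i + k + 1) - orderStat v i ∈ Set.Ioi (((k : ℝ) + 1) / n + ε)}
        ∪ {v | orderStat v (i + k + 1) - orderStat v i ∈ Set.Iio (((k : ℝ) + 1) / n - ε)} := by
    intro v hv
    rw [Set.mem_ofPred_eq] at hv
    rcases lt_abs.1 hv with h | h
    · exact .inl (by simp only [Set.mem_ofPred_eq, Set.mem_Ioi]; linarith)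
    · exact .inr (by simp only [Set.mem_ofPred_eq, Set.mem_Iio]; linarith)
  have h1 : Real.exp (-2 * n * (ε + 1 / n) ^ 2) ≤ Real.exp (-(n : ℝ) * ε ^ 2 / 2) := by
    rw [Real.exp_le_exp]
    have h := pow_le_pow_left₀ hε.le (le_add_of_nonneg_right (by positivity : 0 ≤ 1 / (n : ℝ))) 2
    nlinarith [sq_nonneg ε]
  have h2 : Real.exp (-2 * n * ε ^ 2) ≤ Real.exp (-(n : ℝ) * ε ^ 2 / 2) := by
    rw [Real.exp_le_exp]
    nlinarith [sq_nonneg ε]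
  have := (measureReal_mono (μ := μ) hsub).trans (measureReal_union_le _ _)
  linarith

lemma exp_sum_le_of_large {n : ℕ} (hn : 2 ≤ n) {ε : ℝ} (hε : 0 < ε)
    (hlarge : 1.38 < n * ε ^ 2) :
    Real.exp (-2 * n * (ε + 1 / n) ^ 2) + Real.exp (-2 * n * (ε - 1 / n) ^ 2)
      ≤ 2 * Real.exp (-(n : ℝ) * ε ^ 2 / 2) := by
  have hn0 : (0 : ℝ) < n := by exact_mod_cast (by omega : 0 < n)
  rcases le_or_gt 2 (n * ε) with h | h
  · have hδ : 1 / (n : ℝ) ≤ ε / 2 := by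
      rw [div_le_div_iff₀ hn0 two_pos]
      linarith
    have hδ0 : 0 < 1 / (n : ℝ) := by positivity
    have h1 := pow_le_pow_left₀ (by positivity : 0 ≤ ε / 2) (by linarith : ε / 2 ≤ ε + 1 / n) 2
    have h2 := pow_le_pow_left₀ (by positivity : 0 ≤ ε / 2) (by linarith : ε / 2 ≤ ε - 1 / n) 2
    have e1 : Real.exp (-2 * n * (ε + 1 / n) ^ 2) ≤ Real.exp (-(n : ℝ) * ε ^ 2 / 2) := by
      rw [Real.exp_le_exp]
      nlinarith
    have e2 : Real.exp (-2 * n * (ε - 1 / n) ^ 2) ≤ Real.exp (-(n : ℝ) * ε ^ 2 / 2) := by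
      rw [Real.exp_le_exp]
      nlinarith
    linarith
  · obtain rfl : n = 2 := by
      by_contra hne
      have h3 : (3 : ℝ) ≤ n := by exact_mod_cast (by omega : 3 ≤ n)
      have : (n * ε) * (n * ε) < 4 := by nlinarith [mul_pos hn0 hε]
      nlinarith
    norm_num at h hlarge ⊢
    have hε1 : 0.83 < ε := by nlinarith
    have e1 : Real.exp (-(4 * (ε + 1 / 2) ^ 2)) ≤ 0.04 := by
      rw [Real.exp_neg, inv_le_comm₀ (Real.exp_pos _) (by norm_num)]
      have hx : (7 : ℝ) ≤ 4 * (ε + 1 / 2) ^ 2 := by nlinarith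
      have := Real.quadratic_le_exp_of_nonneg (x := 7) (by norm_num)
      refine le_trans ?_ (this.trans (Real.exp_le_exp.2 hx))
      norm_num
    have e2 : Real.exp (-(4 * (ε - 1 / 2) ^ 2)) ≤ 0.66 := by
      rw [Real.exp_neg, inv_le_comm₀ (Real.exp_pos _) (by norm_num)]
      have hx : (0.4356 : ℝ) ≤ 4 * (ε - 1 / 2) ^ 2 := by nlinarith
      have := Real.quadratic_le_exp_of_nonneg (x := 0.4356) (by norm_num)
      refine le_trans ?_ (this.trans (Real.exp_le_exp.2 hx))
      norm_num
    have e3 : (0.36 : ℝ) ≤ Real.exp (-(2 * ε ^ 2) / 2) := by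
      refine le_trans ?_ (Real.exp_le_exp.2 (by nlinarith : (-1 : ℝ) ≤ -(2 * ε ^ 2) / 2))
      linarith [Real.exp_neg_one_gt_d9]
    norm_num at e1 e2 e3 ⊢
    linarith

lemma one_le_two_mul_exp_neg {y : ℝ} (hy : y ≤ 0.69) : 1 ≤ 2 * Real.exp (-y) := by
  have h : Real.exp y ≤ 2 := by
    rw [← Real.le_log_iff_exp_le two_pos]
    linarith [Real.log_two_gt_d9]
  have hpos := Real.exp_pos (-y)
  have hmul : Real.exp y * Real.exp (-y) = 1 := by rw [← Real.exp_add]; simp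
  nlinarith

lemma initial_deviation_tail {n k : ℕ} (hk : k < n) {ε : ℝ} (hε : 0 < ε) :
    (Measure.pi fun _ : Fin n => unitUniform).real
        {v | ∃ z, 0 ≤ z ∧ z ≤ orderStat v 0 ∧ ε < |orderStat v k - z - ((k : ℝ) + 1) / n|}
      ≤ 2 * Real.exp (-(n : ℝ) * ε ^ 2 / 2) := by
  set μ := Measure.pi fun _ : Fin n => unitUniform
  have hn : (0 : ℝ) < n := by exact_mod_cast (by omega : 0 < n)
  rcases le_or_gt (n * ε ^ 2) 1.38 with hs | hs
  · refine measureReal_le_one.trans ?_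
    have := one_le_two_mul_exp_neg (y := n * ε ^ 2 / 2) (by linarith)
    rwa [show -(n * ε ^ 2 / 2) = -(n : ℝ) * ε ^ 2 / 2 by ring] at this
  have hδ : 1 / (n : ℝ) ≤ ε := by
    rw [div_le_iff₀ hn]
    have h1 : (1 : ℝ) ≤ n := by exact_mod_cast (by omega : 1 ≤ n)
    by_contra! h
    nlinarith
  have hsub : {v : Fin n → ℝ | ∃ z, 0 ≤ z ∧ z ≤ orderStat v 0 ∧
        ε < |orderStat v k - z - ((k : ℝ) + 1) / n|}
      ⊆ {v | ((k : ℝ) + 1) / n + ε < orderStat v k}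
        ∪ {v | orderStat v k - orderStat v 0 < ((k : ℝ) + 1) / n - ε} := by
    rintro v ⟨z, hz0, hz1, hz⟩
    rcases lt_abs.1 hz with h | h
    · exact .inl (by rw [Set.mem_ofPred_eq]; linarith)
    · exact .inr (by rw [Set.mem_ofPred_eq]; linarith)
  have hμ := (measureReal_mono (μ := μ) hsub).trans (measureReal_union_le _ _)
  have hU : μ.real _ ≤ _ := orderStat_upper_tail hk hε.le
  rcases k with _ | k
  · have hL : μ.real {v : Fin n → ℝ | orderStat v 0 - orderStat v 0 < (((0 : ℕ) : ℝ) + 1) / n - ε}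
        = 0 := by
      have : {v : Fin n → ℝ | orderStat v 0 - orderStat v 0 < (((0 : ℕ) : ℝ) + 1) / n - ε} = ∅ := by
        ext v
        simp at hδ ⊢
        exact hδ
      rw [this, measureReal_empty]
    have h1 : Real.exp (-2 * n * (ε + 1 / n) ^ 2) ≤ Real.exp (-(n : ℝ) * ε ^ 2 / 2) := by
      rw [Real.exp_le_exp]
      have h := pow_le_pow_left₀ hε.le
        (le_add_of_nonneg_right (by positivity : 0 ≤ 1 / (n : ℝ))) 2
      nlinarith [sq_nonneg ε]
    linarith [Real.exp_pos (-(n : ℝ) * ε ^ 2 / 2)]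
  · have hL := (measureReal_spacing_le (i := 0) (k := k) (by omega)
      (B := Set.Iio (((k : ℝ) + 1) / n - (ε - 1 / n))) measurableSet_Iio).trans
      (orderStat_lower_tail (by omega) (sub_nonneg.2 hδ))
    have he : {v : Fin n → ℝ | orderStat v (k + 1) - orderStat v 0
          < (((k + 1 : ℕ) : ℝ) + 1) / n - ε}
        = {v | orderStat v (0 + k + 1) - orderStat v 0
          ∈ Set.Iio (((k : ℝ) + 1) / n - (ε - 1 / n))} := by
      ext v
      have : (((k + 1 : ℕ) : ℝ) + 1) / n - ε = ((k : ℝ) + 1) / n - (ε - 1 / n) := by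
        push_cast
        ring
      simp only [Set.mem_ofPred_eq, Set.mem_Iio, this, zero_add]
    rw [← he] at hL
    exact hμ.trans ((add_le_add hU hL).trans (exp_sum_le_of_large (by omega) hε hs))

/-- The probability integral transform. -/
lemma measurePreserving_cdf {ν : Measure ℝ} [IsProbabilityMeasure ν]
    (hc : Continuous (cdf ν)) : MeasurePreserving (cdf ν) ν unitUniform := by
  refine ⟨hc.measurable, ?_⟩
  have : IsProbabilityMeasure (ν.map (cdf ν)) :=
    Measure.isProbabilityMeasure_map hc.measurable.aemeasurable
  refine Measure.ext_of_Iic _ _ fun s => ?_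
  rw [← ENNReal.toReal_eq_toReal_iff' (measure_ne_top _ _) (measure_ne_top _ _)]
  change (ν.map (cdf ν)).real _ = unitUniform.real _
  rw [map_measureReal_apply hc.measurable measurableSet_Iic]
  rcases lt_or_ge s 0 with hs0 | hs0
  · have h1 : cdf ν ⁻¹' Set.Iic s = ∅ := by
      ext x
      simpa using hs0.trans_le (cdf_nonneg ν x)
    have h2 : unitUniform.real (Set.Iic s) ≤ unitUniform.real (Set.Iic 0) :=
      measureReal_mono (Set.Iic_subset_Iic.2 hs0.le)
    rw [unitUniform_real_Iic le_rfl zero_le_one] at h2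
    rw [h1, measureReal_empty]
    exact (le_antisymm h2 measureReal_nonneg).symm
  rcases le_or_gt 1 s with hs1 | hs1
  · have h1 : cdf ν ⁻¹' Set.Iic s = Set.univ := by
      ext x
      simpa using (cdf_le_one ν x).trans hs1
    have h2 : unitUniform.real (Set.Iic 1) ≤ unitUniform.real (Set.Iic s) :=
      measureReal_mono (Set.Iic_subset_Iic.2 hs1)
    rw [unitUniform_real_Iic zero_le_one le_rfl] at h2
    rw [h1, probReal_univ]
    exact le_antisymm h2 measureReal_le_one
  rw [unitUniform_real_Iic hs0 hs1.le]
  rcases (cdf ν ⁻¹' Set.Iic s).eq_empty_or_nonempty with he | hne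
  · rw [he, measureReal_empty]
    refine le_antisymm hs0 (ge_of_tendsto (tendsto_cdf_atBot ν) (Eventually.of_forall fun x => ?_))
    exact (not_le.1 fun h => (he ▸ (show x ∈ cdf ν ⁻¹' Set.Iic s from h) : x ∈ (∅ : Set ℝ))).le
  · obtain ⟨b, hb⟩ := ((tendsto_cdf_atTop ν).eventually (lt_mem_nhds hs1)).exists
    have hbdd : BddAbove (cdf ν ⁻¹' Set.Iic s) := ⟨b, fun x hx => by
      by_contra! h
      exact absurd (hb.trans_le (monotone_cdf ν h.le)) (not_lt.2 hx)⟩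
    have hmem := (isClosed_Iic.preimage hc).csSup_mem hne hbdd
    set x₀ := sSup (cdf ν ⁻¹' Set.Iic s)
    have hIic : cdf ν ⁻¹' Set.Iic s = Set.Iic x₀ := by
      ext x
      exact ⟨fun hx => le_csSup hbdd hx, fun hx => (monotone_cdf ν hx).trans hmem⟩
    rw [hIic, ← cdf_eq_real]
    refine le_antisymm hmem ?_
    have hright : Tendsto (cdf ν) (𝓝[>] x₀) (𝓝 (cdf ν x₀)) :=
      hc.continuousAt.tendsto.mono_left nhdsWithin_le_nhds
    refine ge_of_tendsto hright ?_
    filter_upwards [self_mem_nhdsWithin] with x hx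
    exact (not_le.1 fun h => absurd (le_csSup hbdd h) (not_le.2 hx)).le

lemma errCDF_eq_cdf {p : ℕ} (P : Measure (Obs p)) [IsProbabilityMeasure P] {m : Vec p → ℝ}
    (hm : Measurable m) : errCDF P m = cdf (P.map fun z : Obs p => z.2 - m z.1) := by
  have hres : Measurable fun z : Obs p => z.2 - m z.1 := by fun_prop
  have := Measure.isProbabilityMeasure_map (μ := P) hres.aemeasurable
  ext s
  rw [cdf_eq_real, map_measureReal_apply hres measurableSet_Iic]
  rfl

lemma coverProb_eq_sub {p : ℕ} (P : Measure (Obs p)) [IsProbabilityMeasure P] {m : Vec p → ℝ}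
    (hm : Measurable m) {q₁ q₂ : ℝ} (hq : q₁ ≤ q₂) :
    coverProb P m q₁ q₂ = errCDF P m q₂ - errCDF P m q₁ := by
  have hres : Measurable fun z : Obs p => z.2 - m z.1 := by fun_prop
  have hset : {z : Obs p | m z.1 + q₁ < z.2 ∧ z.2 ≤ m z.1 + q₂}
      = {z : Obs p | z.2 - m z.1 ≤ q₂} \ {z : Obs p | z.2 - m z.1 ≤ q₁} := by
    ext z
    simp only [Set.mem_ofPred_eq, Set.mem_sdiff, not_le, sub_le_iff_le_add']
    exact and_comm
  rw [coverProb, hset]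
  exact measureReal_sdiff (μ := P) (fun z (hz : _ ≤ q₁) => le_trans hz hq)
    (measurableSet_le hres measurable_const)

lemma integral_le_of_gaussian_tail {Ω : Type*} [MeasurableSpace Ω] {μ : Measure Ω} {n : ℕ}
    (hn : 1 ≤ n) {f : Ω → ℝ} (hf : ∀ ω, 0 ≤ f ω)
    (htail : ∀ ε : ℝ, 0 < ε → μ.real {ω | ε < f ω} ≤ 2 * Real.exp (-(n : ℝ) * ε ^ 2 / 2)) :
    ∫ ω, f ω ∂μ ≤ Real.sqrt (2 * Real.pi / n) := by
  have hn0 : (0 : ℝ) < n := by exact_mod_cast hn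
  by_cases hint : Integrable f μ
  swap
  · rw [integral_undef hint]
    exact Real.sqrt_nonneg _
  rw [hint.integral_eq_integral_meas_lt (ae_of_all _ hf)]
  have hg : ∀ t : ℝ, 2 * Real.exp (-(n : ℝ) * t ^ 2 / 2)
      = 2 * Real.exp (-((n : ℝ) / 2) * t ^ 2) := fun t => by ring_nf
  calc ∫ t in Set.Ioi 0, μ.real {a | t < f a}
      ≤ ∫ t in Set.Ioi 0, 2 * Real.exp (-((n : ℝ) / 2) * t ^ 2) := by
        refine integral_mono_of_nonneg (ae_of_all _ fun t => measureReal_nonneg)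
          ((integrable_exp_neg_mul_sq (by positivity)).const_mul 2).integrableOn ?_
        filter_upwards [ae_restrict_mem measurableSet_Ioi] with t ht
        exact (htail t ht).trans_eq (hg t)
    _ = Real.sqrt (2 * Real.pi / n) := by
        rw [integral_const_mul, integral_gaussian_Ioi]
        rw [show Real.pi / ((n : ℝ) / 2) = 2 * Real.pi / n by field_simp]
        ring

lemma coverProb_deviation_tail {p n : ℕ} (hn : 1 ≤ n)
    (P : Measure (Obs p)) [IsProbabilityMeasure P] {m : Vec p → ℝ} (hm : Measurable m)
    (hcont : Continuous (errCDF P m))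
    {α₁ α₂ : ℝ} (h₀ : 0 ≤ α₁) (h₁₂ : α₁ < α₂) (h₂ : α₂ ≤ 1) {ε : ℝ} (hε : 0 < ε) :
    (Measure.pi fun _ : Fin n => P).real
        {T : Fin n → Obs p |
          ε < |coverProb P m (qhat (fun i => (T i).2 - m (T i).1) α₁)
                  (qhat (fun i => (T i).2 - m (T i).1) α₂)
                - ((⌈(n : ℝ) * α₂⌉₊ : ℝ) - (⌈(n : ℝ) * α₁⌉₊ : ℝ)) / n|}
      ≤ 2 * Real.exp (-(n : ℝ) * ε ^ 2 / 2) := by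
  have hn0 : (0 : ℝ) < n := by exact_mod_cast hn
  have hres : Measurable fun z : Obs p => z.2 - m z.1 := by fun_prop
  have hprob := Measure.isProbabilityMeasure_map (μ := P) hres.aemeasurable
  have hF := errCDF_eq_cdf P hm
  have hmono : Monotone (errCDF P m) := hF ▸ monotone_cdf _
  have hpos : ∀ s, 0 ≤ errCDF P m s := fun s => ENNReal.toReal_nonneg
  have hR : MeasurePreserving
      (fun (T : Fin n → Obs p) b => errCDF P m ((T b).2 - m (T b).1))
      (Measure.pi fun _ : Fin n => P) (Measure.pi fun _ : Fin n => unitUniform) := by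
    have hcdf := measurePreserving_cdf (hF ▸ hcont)
    rw [← hF] at hcdf
    exact measurePreserving_pi (fun _ : Fin n => P) (fun _ : Fin n => unitUniform)
      fun _ => hcdf.comp (hres.measurePreserving P)
  have transfer : ∀ {A : Set (Fin n → Obs p)} {S : Set (Fin n → ℝ)},
      (∀ T ∈ A, (fun b => errCDF P m ((T b).2 - m (T b).1)) ∈ S) →
      (Measure.pi fun _ : Fin n => unitUniform).real S ≤ 2 * Real.exp (-(n : ℝ) * ε ^ 2 / 2) →
      (Measure.pi fun _ : Fin n => P).real A ≤ 2 * Real.exp (-(n : ℝ) * ε ^ 2 / 2) := by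
    intro A S hAS hS
    refine le_trans (ENNReal.toReal_mono (measure_ne_top _ _) ?_) hS
    rw [← hR.map_eq]
    exact (measure_mono hAS).trans (Measure.le_map_apply hR.measurable.aemeasurable S)
  have hα₂ : 0 < α₂ := h₀.trans_lt h₁₂
  obtain ⟨k, hk⟩ : ∃ k, ⌈(n : ℝ) * α₂⌉₊ = k + 1 :=
    Nat.exists_eq_add_of_le' (Nat.ceil_pos.2 (by positivity))
  have hkn : k < n := by
    have : ⌈(n : ℝ) * α₂⌉₊ ≤ n := Nat.ceil_le.2 (by nlinarith)
    omega
  have hq₂ : ∀ u : Fin n → ℝ, qhat u α₂ = orderStat u k := fun u => by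
    simp [qhat, hα₂.ne', hk]
  rcases h₀.eq_or_lt with rfl | hα₁
  · refine transfer ?_ (initial_deviation_tail hkn hε)
    intro T hT
    set u : Fin n → ℝ := fun i => (T i).2 - m (T i).1
    have hq₁ : qhat u 0 ≤ orderStat u 0 := by
      simp only [qhat, if_true]
      linarith [Real.exp_pos (-(n : ℝ))]
    rw [Set.mem_ofPred_eq, coverProb_eq_sub P hm
      (hq₂ u ▸ hq₁.trans (orderStat_mono u (Nat.zero_le k))), hq₂,
      hmono.map_orderStat u hkn, hk] at hT
    refine ⟨errCDF P m (qhat u 0), hpos _, ?_, by simpa [Function.comp_def] using hT⟩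
    exact (hmono hq₁).trans_eq (hmono.map_orderStat u (by omega))
  · obtain ⟨i, hi⟩ : ∃ i, ⌈(n : ℝ) * α₁⌉₊ = i + 1 :=
      Nat.exists_eq_add_of_le' (Nat.ceil_pos.2 (by positivity))
    have hik : i ≤ k := by
      have : ⌈(n : ℝ) * α₁⌉₊ ≤ ⌈(n : ℝ) * α₂⌉₊ :=
        Nat.ceil_mono (mul_le_mul_of_nonneg_left h₁₂.le hn0.le)
      omega
    have hq₁ : ∀ u : Fin n → ℝ, qhat u α₁ = orderStat u i := fun u => by
      simp [qhat, hα₁.ne', hi]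
    have hcover : ∀ u : Fin n → ℝ, coverProb P m (qhat u α₁) (qhat u α₂)
        = orderStat (errCDF P m ∘ u) k - orderStat (errCDF P m ∘ u) i := fun u => by
      rw [hq₁, hq₂, coverProb_eq_sub P hm (orderStat_mono u hik), hmono.map_orderStat u hkn,
        hmono.map_orderStat u (by omega)]
    rcases hik.eq_or_lt with rfl | hlt
    · have : {T : Fin n → Obs p |
          ε < |coverProb P m (qhat (fun i => (T i).2 - m (T i).1) α₁)
                  (qhat (fun i => (T i).2 - m (T i).1) α₂)
                - ((⌈(n : ℝ) * α₂⌉₊ : ℝ) - (⌈(n : ℝ) * α₁⌉₊ : ℝ)) / n|} = ∅ := by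
        ext T
        simp [hcover, hi, hk, hε.le]
      rw [this, measureReal_empty]
      positivity
    · obtain ⟨d, rfl⟩ : ∃ d, k = i + d + 1 := ⟨k - i - 1, by omega⟩
      refine transfer ?_ (spacing_deviation_tail (i := i) (k := d) hkn hε)
      intro T hT
      rw [Set.mem_ofPred_eq, hcover, hk, hi] at hT
      rw [Set.mem_ofPred_eq]
      have hd : ((i + d + 1 + 1 : ℕ) : ℝ) - ((i + 1 : ℕ) : ℝ) = (d : ℝ) + 1 := by
        push_cast
        ring
      rwa [hd] at hT

/-- Section 5.2 of the paper: for a predictor `m` that does not depend on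
the training data, the leave-one-out prediction interval satisfies a DKW-type exponential
tail bound and the resulting expectation bound `√(2π/n)`. -/
theorem stmt19 {p n : ℕ} (hn : 1 ≤ n)
    (P : Measure (Obs p)) [IsProbabilityMeasure P]
    (m : Vec p → ℝ) (hm : Measurable m)
    (hcont : Continuous fun s : ℝ => errCDF P m s)
    (α₁ α₂ : ℝ) (h₀ : 0 ≤ α₁) (h₁₂ : α₁ < α₂) (h₂ : α₂ ≤ 1) :
    (∀ ε : ℝ, 0 < ε →
      ((Measure.pi fun _ : Fin n => P)
        {T : Fin n → Obs p |
          ε < |coverProb P m (qhat (fun i => (T i).2 - m (T i).1) α₁)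
                  (qhat (fun i => (T i).2 - m (T i).1) α₂)
                - ((⌈(n : ℝ) * α₂⌉₊ : ℝ) - (⌈(n : ℝ) * α₁⌉₊ : ℝ)) / n|}).toReal
        ≤ 2 * Real.exp (-(n : ℝ) * ε ^ 2 / 2))
    ∧ (∫ T : Fin n → Obs p,
          |coverProb P m (qhat (fun i => (T i).2 - m (T i).1) α₁)
              (qhat (fun i => (T i).2 - m (T i).1) α₂)
            - ((⌈(n : ℝ) * α₂⌉₊ : ℝ) - (⌈(n : ℝ) * α₁⌉₊ : ℝ)) / n|
          ∂(Measure.pi fun _ : Fin n => P))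
        ≤ Real.sqrt (2 * Real.pi / n) := by
  refine ⟨fun ε hε => coverProb_deviation_tail hn P hm hcont h₀ h₁₂ h₂ hε, ?_⟩
  exact integral_le_of_gaussian_tail hn (fun T => abs_nonneg _)
    fun ε hε => coverProb_deviation_tail hn P hm hcont h₀ h₁₂ h₂ hε

end
end
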